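/- arXiv:0811.4067 — 2 statements merged into one kernel-verified Lean document; each statement's English description precedes it below -/
import Mathlib

section
/- For every n ≥ 1, the smallest ℂ-linear subspace of R that contains d_0 and is invariant under every derivation p_{a,b,w} with a,b ∈ ℕ, w ∈ ℤ and w ≤ a+b, contains d_{I,J} for all strictly increasing tuples I, J ∈ ℕ^{n+1}; equivalently, this smallest invariant subspace is exactly U_n. (This is the associated-graded form of the theorem that the singular vector D_0 generates the maximal proper submodule I_{−n} of M_{−n} over the parabolic Lie algebra P.) -/
open MvPolynomial

noncomputable section

/-- The polynomial ring `R = ℂ[Q_{a,b} : a,b ∈ ℕ]`. -/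
abbrev RR : Type := MvPolynomial (ℕ × ℕ) ℂ

/-- The coefficient `λ(a,b,w,l) = (−1)^{b+1}·(b+l)!/(l+w−a)!` if `l+w−a ≥ 0`, else `0`. -/
def lamC (a b : ℕ) (w : ℤ) (l : ℕ) : ℂ :=
  if 0 ≤ (l : ℤ) + w - a then
    (-1) ^ (b + 1) * (Nat.factorial (b + l) : ℂ) /
      (Nat.factorial ((l : ℤ) + w - a).toNat : ℂ)
  else 0

/-- The coefficient `μ(a,b,w,m) = (−1)^a·(a+m)!/(m+w−b)!` if `m+w−b ≥ 0`, else `0`. -/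
def muC (a b : ℕ) (w : ℤ) (m : ℕ) : ℂ :=
  if 0 ≤ (m : ℤ) + w - b then
    (-1) ^ a * (Nat.factorial (a + m) : ℂ) /
      (Nat.factorial ((m : ℤ) + w - b).toNat : ℂ)
  else 0

/-- The derivation `p_{a,b,w}` of `R` with
`p_{a,b,w}(Q_{l,m}) = λ(a,b,w,l)·Q_{l+w,m} + μ(a,b,w,m)·Q_{l,m+w}`, where a summand is
interpreted as `0` whenever its coefficient is `0` (a nonzero coefficient forces the
corresponding shifted index to be a nonnegative integer). -/
def pDer (a b : ℕ) (w : ℤ) : Derivation ℂ RR RR :=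
  MvPolynomial.mkDerivation ℂ fun lm : ℕ × ℕ =>
    lamC a b w lm.1 • X (((lm.1 : ℤ) + w).toNat, lm.2) +
      muC a b w lm.2 • X (lm.1, ((lm.2 : ℤ) + w).toNat)

/-- The determinant `d_{I,J}` of the `(n+1)×(n+1)` matrix with `(r,s)` entry `Q_{i_r,j_s}`. -/
def dDet (n : ℕ) (I J : Fin (n + 1) → ℕ) : RR :=
  Matrix.det (Matrix.of fun r s => (X (I r, J s) : RR))

/-- The span `U_n ⊆ R` of the determinants `d_{I,J}` over strictly increasing `I, J`. -/
def Un (n : ℕ) : Submodule ℂ RR :=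
  Submodule.span ℂ
    {p : RR | ∃ I J : Fin (n + 1) → ℕ, StrictMono I ∧ StrictMono J ∧ p = dDet n I J}

/-- The tuple `ι = (0,1,…,n)`. -/
def iot (n : ℕ) : Fin (n + 1) → ℕ := fun r => (r : ℕ)

theorem der_prod {ι : Type*} [DecidableEq ι] (D : Derivation ℂ RR RR) (s : Finset ι) (g : ι → RR) :
    D (∏ i ∈ s, g i) = ∑ i ∈ s, (∏ j ∈ s.erase i, g j) * D (g i) := by
  induction s using Finset.induction_on with
  | empty => simp
  | insert a s ha ih =>
    rw [Finset.prod_insert ha, Derivation.leibniz, ih, Finset.sum_insert ha,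
      Finset.erase_insert ha, smul_eq_mul, smul_eq_mul, add_comm, Finset.mul_sum]
    congr 1
    refine Finset.sum_congr rfl fun i hi => ?_
    have hne : a ≠ i := fun h => ha (h ▸ hi)
    rw [Finset.erase_insert_of_ne hne, Finset.prod_insert (by simp [ha])]
    ring

theorem der_det (n : ℕ) (D : Derivation ℂ RR RR) (α β : ℕ → ℂ) (s t : ℕ → ℕ)
    (hD : ∀ l m, D (X (l, m)) = α l • X (s l, m) + β m • X (l, t m))
    (I J : Fin (n + 1) → ℕ) :
    D (dDet n I J) = ∑ r, α (I r) • dDet n (Function.update I r (s (I r))) J +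
      ∑ r, β (J r) • dDet n I (Function.update J r (t (J r))) := by
  have key : ∀ σ : Equiv.Perm (Fin (n + 1)), D (∏ i, (X (I (σ i), J i) : RR)) =
      ∑ r, α (I r) • ∏ i, (X (Function.update I r (s (I r)) (σ i), J i) : RR) +
      ∑ r, β (J r) • ∏ i, (X (I (σ i), Function.update J r (t (J r)) i) : RR) := by
    intro σ
    rw [der_prod]
    simp only [hD, mul_add, Finset.sum_add_distrib]
    congr 1
    · rw [← Equiv.sum_comp σ (fun r => α (I r) •
        ∏ i, (X (Function.update I r (s (I r)) (σ i), J i) : RR))]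
      refine Finset.sum_congr rfl fun i _ => ?_
      rw [← Finset.prod_erase_mul _ _ (Finset.mem_univ i), mul_smul_comm, Function.update_self]
      congr 2
      refine Finset.prod_congr rfl fun j hj => ?_
      rw [Function.update_of_ne (fun h => (Finset.ne_of_mem_erase hj) (σ.injective h))]
    · refine Finset.sum_congr rfl fun i _ => ?_
      rw [← Finset.prod_erase_mul _ _ (Finset.mem_univ i), mul_smul_comm, Function.update_self]
      congr 2
      refine Finset.prod_congr rfl fun j hj => ?_
      rw [Function.update_of_ne (Finset.ne_of_mem_erase hj)]
  simp only [dDet, Matrix.det_apply, Matrix.of_apply, map_sum, Finset.smul_sum]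
  rw [Finset.sum_comm, Finset.sum_comm (s := (Finset.univ : Finset (Fin (n + 1)))),
    ← Finset.sum_add_distrib]
  refine Finset.sum_congr rfl fun σ _ => ?_
  rw [Units.smul_def, map_zsmul, key, smul_add, Finset.smul_sum, Finset.smul_sum]
  congr 1 <;>
  · refine Finset.sum_congr rfl fun r _ => ?_
    rw [Units.smul_def, smul_comm]

theorem dDet_perm_left (n : ℕ) (I J : Fin (n + 1) → ℕ) (σ : Equiv.Perm (Fin (n + 1))) :
    dDet n (I ∘ σ) J = ((Equiv.Perm.sign σ : ℤ) : RR) * dDet n I J :=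
  Matrix.det_permute σ (Matrix.of fun r s => (X (I r, J s) : RR))

theorem dDet_perm_right (n : ℕ) (I J : Fin (n + 1) → ℕ) (σ : Equiv.Perm (Fin (n + 1))) :
    dDet n I (J ∘ σ) = ((Equiv.Perm.sign σ : ℤ) : RR) * dDet n I J :=
  Matrix.det_permute' σ (Matrix.of fun r s => (X (I r, J s) : RR))

theorem sign_mul_mem (U : Submodule ℂ RR) (σ : ℤˣ) (x : RR)
    (h : ((σ : ℤ) : RR) * x ∈ U) : x ∈ U := by
  rcases Int.units_eq_one_or σ with h1 | h1 <;> subst h1 <;> simpa using h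

theorem dDet_mem_Un (n : ℕ) (I J : Fin (n + 1) → ℕ) : dDet n I J ∈ Un n := by
  by_cases hI : Function.Injective I
  · by_cases hJ : Function.Injective J
    · apply sign_mul_mem _ (Equiv.Perm.sign (Tuple.sort I))
      rw [← dDet_perm_left]
      apply sign_mul_mem _ (Equiv.Perm.sign (Tuple.sort J))
      rw [← dDet_perm_right]
      refine Submodule.subset_span ⟨_, _, ?_, ?_, rfl⟩
      · exact (Tuple.monotone_sort I).strictMono_of_injective (hI.comp (Equiv.injective _))
      · exact (Tuple.monotone_sort J).strictMono_of_injective (hJ.comp (Equiv.injective _))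
    · simp only [Function.Injective, not_forall] at hJ
      obtain ⟨i, j, h, hne⟩ := hJ
      have : dDet n I J = 0 := Matrix.det_zero_of_column_eq hne (by simp [h])
      rw [this]; exact zero_mem _
  · simp only [Function.Injective, not_forall] at hI
    obtain ⟨i, j, h, hne⟩ := hI
    have : dDet n I J = 0 := Matrix.det_zero_of_row_eq hne (by funext s; simp [h])
    rw [this]; exact zero_mem _

theorem pDer_mem_Un (n a b : ℕ) (w : ℤ) (x : RR) (hx : x ∈ Un n) : pDer a b w x ∈ Un n := by
  induction hx using Submodule.span_induction with
  | mem x h =>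
    obtain ⟨I, J, -, -, rfl⟩ := h
    rw [der_det n (pDer a b w) (lamC a b w) (muC a b w) (fun l => ((l : ℤ) + w).toNat)
      (fun l => ((l : ℤ) + w).toNat) (fun l m => by simp [pDer, mkDerivation_X])]
    exact add_mem (sum_mem fun r _ => Submodule.smul_mem _ _ (dDet_mem_Un _ _ _))
      (sum_mem fun r _ => Submodule.smul_mem _ _ (dDet_mem_Un _ _ _))
  | zero => simp
  | add x y _ _ hx hy => rw [map_add]; exact add_mem hx hy
  | smul c x _ hx => rw [Derivation.map_smul]; exact Submodule.smul_mem _ _ hx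

/-- The derivation attached to a polynomial and a nonnegative shift. -/
def fDer (w : ℕ) (f : Polynomial ℂ) : Derivation ℂ RR RR :=
  MvPolynomial.mkDerivation ℂ fun lm : ℕ × ℕ =>
    f.eval (lm.1 : ℂ) • X (lm.1 + w, lm.2) +
      ((-1) ^ (w + 1) * f.eval (-(lm.2 : ℂ) - w - 1)) • X (lm.1, lm.2 + w)

theorem fDer_X (w : ℕ) (f : Polynomial ℂ) (l m : ℕ) : fDer w f (X (l, m)) =
    f.eval (l : ℂ) • X (l + w, m) +
      ((-1) ^ (w + 1) * f.eval (-(m : ℂ) - w - 1)) • X (l, m + w) := by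
  simp [fDer, mkDerivation_X]

theorem desc_eval_neg (k N : ℕ) : (descPochhammer ℂ k).eval (-(N : ℂ) - 1) * (N.factorial : ℂ)
    = (-1) ^ k * ((N + k).factorial : ℂ) := by
  induction k with
  | zero => simp
  | succ k ih =>
    rw [descPochhammer_succ_eval, mul_right_comm, ih, ← add_assoc, Nat.factorial_succ]
    push_cast
    ring

theorem fDer_desc (w k : ℕ) :
    fDer w (descPochhammer ℂ k) = - pDer (k + w) 0 (w : ℤ) := by
  apply MvPolynomial.derivation_ext
  rintro ⟨l, m⟩
  have h1 : (descPochhammer ℂ k).eval (l : ℂ) = - lamC (k + w) 0 w l := by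
    rw [descPochhammer_eval_eq_descFactorial, lamC]
    split_ifs with h
    · have hk : k ≤ l := by push_cast at h; omega
      have e : ((l : ℤ) + w - ((k + w : ℕ) : ℤ)).toNat = l - k := by omega
      rw [e]
      have := Nat.factorial_ne_zero (l - k)
      simp only [zero_add, ← Nat.factorial_mul_descFactorial hk]
      push_cast
      field_simp
    · have hk : l < k := by push_cast at h; omega
      simp [Nat.descFactorial_of_lt hk]
  have h2 : ((-1) ^ (w + 1) * (descPochhammer ℂ k).eval (-(m : ℂ) - w - 1))
      = - muC (k + w) 0 w m := by
    have h0 := desc_eval_neg k (m + w)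
    have hne : ((m + w).factorial : ℂ) ≠ 0 := by exact_mod_cast Nat.factorial_ne_zero _
    have e1 : (-((m + w : ℕ) : ℂ) - 1) = -(m : ℂ) - w - 1 := by push_cast; ring
    rw [e1] at h0
    have e : ((m : ℤ) + w - ((0 : ℕ) : ℤ)).toNat = m + w := by omega
    rw [muC, if_pos (by push_cast; omega), e, eq_div_of_mul_eq hne h0,
      show k + w + m = m + w + k by ring]
    ring
  rw [fDer_X, h1, h2, Derivation.neg_apply, pDer, mkDerivation_X]
  have e1 : ((l : ℤ) + w).toNat = l + w := by omega
  have e2 : ((m : ℤ) + w).toNat = m + w := by omega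
  simp only [e1, e2, neg_smul, neg_add]

/-- The falling factorials as a polynomial sequence. -/
def descSeq : Polynomial.Sequence ℂ where
  elems' := fun k => descPochhammer ℂ k
  degree_eq' := fun k => by
    rw [Polynomial.degree_eq_natDegree (monic_descPochhammer ℂ k).ne_zero,
      descPochhammer_natDegree]

theorem fDer_mem (W : Submodule ℂ RR)
    (hW : ∀ (a b : ℕ) (w : ℤ), w ≤ (a : ℤ) + b → ∀ x ∈ W, pDer a b w x ∈ W)
    (w : ℕ) (f : Polynomial ℂ) (x : RR) (hx : x ∈ W) : fDer w f x ∈ W := by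
  have hs := descSeq.span (fun i => by
    have : (descSeq i).leadingCoeff = 1 := monic_descPochhammer ℂ i
    rw [this]; exact isUnit_one)
  have hf : f ∈ Submodule.span ℂ (Set.range descSeq) := by rw [hs]; trivial
  induction hf using Submodule.span_induction with
  | mem g h =>
    obtain ⟨k, rfl⟩ := h
    have e : fDer w (descSeq k) = - pDer (k + w) 0 (w : ℤ) := fDer_desc w k
    rw [e, Derivation.neg_apply]
    exact neg_mem (hW _ _ _ (by push_cast; omega) _ hx)
  | zero =>
    have : fDer w 0 = 0 := by
      apply MvPolynomial.derivation_ext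
      rintro ⟨l, m⟩
      simp [fDer_X]
    simp [this]
  | add f g _ _ hf hg =>
    have : fDer w (f + g) = fDer w f + fDer w g := by
      apply MvPolynomial.derivation_ext
      rintro ⟨l, m⟩
      simp only [fDer_X, Derivation.add_apply, Polynomial.eval_add, mul_add, add_smul]
      abel
    rw [this]; exact add_mem hf hg
  | smul c f _ hf =>
    have : fDer w (c • f) = c • fDer w f := by
      apply MvPolynomial.derivation_ext
      rintro ⟨l, m⟩
      simp only [fDer_X, Derivation.smul_apply, Polynomial.eval_smul, smul_add, smul_smul,
        smul_eq_mul]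
      congr 2
      ring
    rw [this]; exact Submodule.smul_mem _ _ hf

theorem neg_ne_aux (l m w : ℕ) : (l : ℂ) ≠ -(m : ℂ) - w - 1 := by
  intro h
  have h2 : ((l + m + w + 1 : ℕ) : ℂ) = 0 := by push_cast; rw [h]; ring
  exact absurd (Nat.cast_eq_zero.mp h2) (by omega)

theorem exists_sep (S : Finset ℂ) (z : ℂ) (hz : z ∈ S) :
    ∃ f : Polynomial ℂ, f.eval z = 1 ∧ ∀ y ∈ S, y ≠ z → f.eval y = 0 := by
  refine ⟨Lagrange.basis S id z, ?_, fun y hy hne => ?_⟩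
  · exact Lagrange.eval_basis_self (v := id) (Function.injective_id.injOn) hz
  · exact Lagrange.eval_basis_of_ne (v := id) (Ne.symm hne) hy

theorem move_left (n : ℕ) (W : Submodule ℂ RR)
    (hW : ∀ (a b : ℕ) (w : ℤ), w ≤ (a : ℤ) + b → ∀ x ∈ W, pDer a b w x ∈ W)
    (I J : Fin (n + 1) → ℕ) (hI : Function.Injective I) (h : dDet n I J ∈ W)
    (r : Fin (n + 1)) (w : ℕ) : dDet n (Function.update I r (I r + w)) J ∈ W := by
  obtain ⟨f, f1, f0⟩ := exists_sep (Finset.univ.image (fun r => (I r : ℂ)) ∪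
    Finset.univ.image (fun s => -(J s : ℂ) - w - 1)) (I r) (by simp)
  have := fDer_mem W hW w f _ h
  rw [der_det n _ _ (fun m => (-1) ^ (w + 1) * f.eval (-(m : ℂ) - w - 1)) _ _ (fDer_X w f),
    Finset.sum_eq_single r, f1, one_smul, Finset.sum_eq_zero, add_zero] at this
  · exact this
  · intro s _
    rw [f0 _ (by simp) (neg_ne_aux _ _ _).symm]
    simp
  · intro s _ hs
    rw [f0 _ (by simp) (fun e => hs (hI (Nat.cast_injective e)))]
    simp
  · simp

theorem move_right (n : ℕ) (W : Submodule ℂ RR)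
    (hW : ∀ (a b : ℕ) (w : ℤ), w ≤ (a : ℤ) + b → ∀ x ∈ W, pDer a b w x ∈ W)
    (I J : Fin (n + 1) → ℕ) (hJ : Function.Injective J) (h : dDet n I J ∈ W)
    (r : Fin (n + 1)) (w : ℕ) : dDet n I (Function.update J r (J r + w)) ∈ W := by
  obtain ⟨f, f1, f0⟩ := exists_sep (Finset.univ.image (fun r => (I r : ℂ)) ∪
    Finset.univ.image (fun s => -(J s : ℂ) - w - 1)) (-(J r : ℂ) - w - 1) (by simp)
  have := fDer_mem W hW w f _ h
  rw [der_det n _ _ (fun m => (-1) ^ (w + 1) * f.eval (-(m : ℂ) - w - 1)) _ _ (fDer_X w f),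
    Finset.sum_eq_zero, zero_add, Finset.sum_eq_single r, f1, mul_one] at this
  · exact (Submodule.smul_mem_iff _ (pow_ne_zero _ (by norm_num))).mp this
  · intro s _ hs
    rw [f0 _ (by simp) (fun e => hs (hJ (Nat.cast_injective (R := ℂ) (by linear_combination -e)))) ]
    simp
  · simp
  · intro s _
    rw [f0 _ (by simp) (neg_ne_aux _ _ _)]
    simp

/-- Intermediate tuples. -/
def mid (n : ℕ) (I : Fin (n + 1) → ℕ) (t : ℕ) : Fin (n + 1) → ℕ :=
  fun r => if (r : ℕ) < t then (r : ℕ) else I r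

theorem le_strictMono (n : ℕ) (I : Fin (n + 1) → ℕ) (hI : StrictMono I) (r : Fin (n + 1)) :
    (r : ℕ) ≤ I r := by
  obtain ⟨r, hr⟩ := r
  induction r with
  | zero => simp
  | succ r ih =>
    have h1 := ih (by omega)
    have h2 : I ⟨r, by omega⟩ < I ⟨r + 1, hr⟩ := hI (by simp)
    simp only at h1 ⊢
    omega

theorem mid_inj (n : ℕ) (I : Fin (n + 1) → ℕ) (hI : StrictMono I) (t : ℕ) :
    Function.Injective (mid n I t) := by
  apply StrictMono.injective
  intro r s hrs
  have h1 := le_strictMono n I hI s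
  have h2 := hI hrs
  have h3 : (r : ℕ) < s := hrs
  unfold mid
  split_ifs <;> omega

theorem mid_reach (n : ℕ) (I : Fin (n + 1) → ℕ) (hI : StrictMono I)
    (P : (Fin (n + 1) → ℕ) → Prop) (h0 : P (iot n))
    (hP : ∀ K, Function.Injective K → P K → ∀ r w, P (Function.update K r (K r + w))) : P I := by
  have h1 : mid n I (n + 1) = iot n := by
    funext r; simp only [mid, iot, if_pos r.isLt]
  have h2 : mid n I 0 = I := by
    funext r; simp [mid]
  have h3 : ∀ t, t ≤ n + 1 → P (mid n I (n + 1 - t)) := by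
    intro t
    induction t with
    | zero => intro _; simpa [h1] using h0
    | succ t ih =>
      intro ht
      have hp := ih (by omega)
      have hl := le_strictMono n I hI ⟨n - t, by omega⟩
      have := hP _ (mid_inj n I hI _) hp ⟨n - t, by omega⟩ (I ⟨n - t, by omega⟩ - (n - t))
      convert this using 1
      funext r
      by_cases hr : r = ⟨n - t, by omega⟩
      · subst hr
        simp only [Function.update_self, mid]
        simp only at hl
        split_ifs <;> omega
      · rw [Function.update_of_ne hr]
        have : (r : ℕ) ≠ n - t := fun e => hr (Fin.ext e)
        unfold mid
        split_ifs <;> omega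
  simpa [h2] using h3 (n + 1) le_rfl

/-- The smallest ℂ-subspace of `R` containing `d_0` and invariant under every derivation
`p_{a,b,w}` with `w ≤ a + b` is exactly `U_n`; in particular it contains `d_{I,J}` for all
strictly increasing `I, J`. (Associated-graded form of: the singular vector `D_0` generates
the maximal proper submodule `I_{−n}` of `M_{−n}` over the parabolic Lie algebra `P`.) -/
theorem sInf_invariant_eq_Un (n : ℕ) (hn : 1 ≤ n) :
    sInf {W : Submodule ℂ RR | dDet n (iot n) (iot n) ∈ W ∧
      ∀ (a b : ℕ) (w : ℤ), w ≤ (a : ℤ) + b → ∀ x ∈ W, pDer a b w x ∈ W} = Un n := by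
  apply le_antisymm
  · exact sInf_le ⟨dDet_mem_Un _ _ _, fun a b w _ x hx => pDer_mem_Un n a b w x hx⟩
  · refine le_sInf ?_
    rintro W ⟨h0, hW⟩
    refine Submodule.span_le.mpr ?_
    rintro _ ⟨I, J, hI, hJ, rfl⟩
    refine mid_reach n J hJ (fun K => dDet n I K ∈ W) ?_
      (fun K hK h r w => move_right n W hW I K hK h r w)
    exact mid_reach n I hI (fun K => dDet n K (iot n) ∈ W) h0
      (fun K hK h r w => move_left n W hW K _ hK h r w)
end
end

section
/- For every n ≥ 1, p_{0,1,−1}(d_{(1,2,…,n+1),(1,2,…,n+1)}) = 2·d_{(0,2,3,…,n+1),(1,2,…,n+1)}. -/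
open MvPolynomial

noncomputable section

theorem der_prod_aux {ι : Type*} [DecidableEq ι] (D : Derivation ℂ RR RR) (s : Finset ι)
    (f : ι → RR) :
    D (∏ i ∈ s, f i) = ∑ i ∈ s, ∏ j ∈ s, (if j = i then D (f j) else f j) := by
  induction s using Finset.induction_on with
  | empty => simp
  | insert a s ha ih =>
    rw [Finset.prod_insert ha, D.leibniz, ih, Finset.sum_insert ha, Finset.prod_insert ha]
    have h1 : ∏ j ∈ s, (if j = a then D (f j) else f j) = ∏ j ∈ s, f j := by
      apply Finset.prod_congr rfl
      intro j hj
      rw [if_neg]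
      rintro rfl
      exact ha hj
    rw [h1, if_pos rfl, add_comm, smul_eq_mul, smul_eq_mul, Finset.mul_sum, mul_comm]
    congr 1
    apply Finset.sum_congr rfl
    intro i hi
    rw [Finset.prod_insert ha, if_neg]
    rintro rfl
    exact ha hi

theorem der_det_aux {n : ℕ} (D : Derivation ℂ RR RR) (M : Matrix (Fin n) (Fin n) RR) :
    D M.det = ∑ i, (M.updateCol i (fun r => D (M r i))).det := by
  simp only [Matrix.det_apply]
  rw [map_sum, Finset.sum_comm]
  apply Finset.sum_congr rfl
  intro σ _
  rw [← Finset.smul_sum]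
  have : ∀ (u : ℤˣ) (x : RR), D (u • x) = u • D x := by
    intro u x
    rcases Int.units_eq_one_or u with rfl | rfl <;> simp
  rw [this, der_prod_aux]
  congr 1
  apply Finset.sum_congr rfl
  intro i _
  apply Finset.prod_congr rfl
  intro j _
  rw [Matrix.updateCol_apply]
  split_ifs with h
  · rw [h]
  · rfl

theorem sum_col_row_aux {n : ℕ} (M A : Matrix (Fin n) (Fin n) RR) :
    ∑ i, (M.updateCol i (fun r => A r i)).det = ∑ i, (M.updateRow i (A i)).det := by
  simp only [← Matrix.cramer_apply, ← Matrix.cramer_transpose_apply,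
    Matrix.cramer_eq_adjugate_mulVec, ← Matrix.adjugate_transpose, Matrix.mulVec, dotProduct,
    Matrix.transpose_apply]
  rw [Finset.sum_comm]

theorem pDer_X_aux (l m : ℕ) : pDer 0 1 (-1) (X (l + 1, m + 1)) =
    lamC 0 1 (-1) (l + 1) • X (l, m + 1) + muC 0 1 (-1) (m + 1) • X (l + 1, m) := by
  simp [pDer, mkDerivation_X]

/-- `p_{0,1,−1}(d_{(1,…,n+1),(1,…,n+1)}) = 2·d_{(0,2,3,…,n+1),(1,…,n+1)}`. -/
theorem pDer_zero_one_neg_one (n : ℕ) (hn : 1 ≤ n) :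
    pDer 0 1 (-1) (dDet n (fun r => (r : ℕ) + 1) (fun r => (r : ℕ) + 1)) =
      (2 : ℂ) • dDet n (Function.update (fun r : Fin (n + 1) => (r : ℕ) + 1) 0 0)
        (fun r => (r : ℕ) + 1) := by
  set M : Matrix (Fin (n + 1)) (Fin (n + 1)) RR :=
    Matrix.of fun r s => (X ((r : ℕ) + 1, (s : ℕ) + 1) : RR) with hM
  set A : Matrix (Fin (n + 1)) (Fin (n + 1)) RR :=
    Matrix.of fun r s => (C (lamC 0 1 (-1) ((r : ℕ) + 1)) * X ((r : ℕ), (s : ℕ) + 1) : RR) with hA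
  have h0 : dDet n (fun r => (r : ℕ) + 1) (fun r => (r : ℕ) + 1) = M.det := rfl
  rw [h0, der_det_aux]
  have h1 : ∀ i : Fin (n + 1), (M.updateCol i (fun r => pDer 0 1 (-1) (M r i))).det =
      (M.updateCol i (fun r => A r i)).det := by
    intro i
    have e : (fun r => pDer 0 1 (-1) (M r i)) = (fun r => A r i) +
        (C (muC 0 1 (-1) ((i : ℕ) + 1)) : RR) • (fun r : Fin (n + 1) => X ((r : ℕ) + 1, (i : ℕ))) := by
      funext r
      simp only [hM, hA, Matrix.of_apply, pDer_X_aux, Pi.add_apply, Pi.smul_apply, smul_eq_mul,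
        MvPolynomial.smul_eq_C_mul]
    rw [e, Matrix.det_updateCol_add, Matrix.det_updateCol_smul]
    refine add_eq_left.mpr ?_
    refine Fin.cases ?_ (fun k => ?_) i
    · simp [muC]
    · have hne : k.castSucc ≠ k.succ := (Fin.castSucc_lt_succ).ne
      rw [Matrix.det_zero_of_column_eq hne, mul_zero]
      intro r
      rw [Matrix.updateCol_self, Matrix.updateCol_ne hne]
      simp [hM]
  rw [Finset.sum_congr rfl (fun i _ => h1 i), sum_col_row_aux, Fin.sum_univ_succ]
  have h2 : ∀ k : Fin n, (M.updateRow k.succ (A k.succ)).det = 0 := by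
    intro k
    have hne : k.castSucc ≠ k.succ := (Fin.castSucc_lt_succ).ne
    have e : A k.succ = (C (lamC 0 1 (-1) ((k.succ : ℕ) + 1)) : RR) • M k.castSucc := by
      funext s
      simp [hM, hA]
    rw [e, Matrix.det_updateRow_smul, Matrix.det_zero_of_row_eq hne, mul_zero]
    rw [Matrix.updateRow_self, Matrix.updateRow_ne hne]
  rw [Finset.sum_congr rfl (fun k _ => h2 k), Finset.sum_const_zero, add_zero]
  have e : A 0 = (C 2 : RR) • (fun s : Fin (n + 1) => (X (0, (s : ℕ) + 1) : RR)) := by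
    funext s
    have hl : lamC 0 1 (-1) (0 + 1) = 2 := by
      norm_num [lamC, Nat.factorial]
    simp only [hA, Matrix.of_apply, Fin.val_zero, hl, Pi.smul_apply, smul_eq_mul]
  rw [e, Matrix.det_updateRow_smul, MvPolynomial.smul_eq_C_mul]
  congr 1
  unfold dDet
  congr 1
  ext1 r s
  rw [Matrix.updateRow_apply, Matrix.of_apply, Function.update_apply]
  split_ifs with h
  · rfl
  · rfl
end
end
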